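/- Let d₁ ≤ d₂, let X, Z ∈ ℂ^{d₁×d₂} and ε > 0. Then ‖Z‖_{0,ε}⁰ ≤ ‖X‖_{0,ε}⁰ + tr((XX^* + ε²I_{d₁})⁻¹ (ZZ^* − XX^*)). In other words, the affine function Z ↦ ‖X‖_{0,ε}⁰ + tr((XX^* + ε²I_{d₁})⁻¹(ZZ^* − XX^*)) is a global majorizer of Z ↦ ‖Z‖_{0,ε}⁰ that is tight at Z = X. -/

import Mathlib

open Matrix

/-- The `d₁ × d₂` rectangular diagonal matrix whose `(i,i)`-th entries are the real
numbers `σ i`, `i < min d₁ d₂`, and whose other entries vanish. -/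
noncomputable def rectDiag (d₁ d₂ : ℕ) (σ : Fin (min d₁ d₂) → ℝ) :
    Matrix (Fin d₁) (Fin d₂) ℂ :=
  fun i j => if h : (i : ℕ) = (j : ℕ) then
    ((σ ⟨(i : ℕ), by have := i.isLt; have := j.isLt; omega⟩ : ℝ) : ℂ) else 0

/-- `σ₁ ≥ … ≥ σ_d ≥ 0` (with `d = min d₁ d₂`) are the singular values of
`X ∈ ℂ^{d₁×d₂}`, listed in non-increasing order: `σ` is antitone, nonnegative, and
`X = U Σ V^*` for unitary `U, V` with `Σ` the rectangular diagonal matrix of `σ`. -/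
def IsSVD (d₁ d₂ : ℕ) (X : Matrix (Fin d₁) (Fin d₂) ℂ) (σ : Fin (min d₁ d₂) → ℝ) : Prop :=
  Antitone σ ∧ (∀ i, 0 ≤ σ i) ∧
    ∃ U ∈ Matrix.unitaryGroup (Fin d₁) ℂ, ∃ V ∈ Matrix.unitaryGroup (Fin d₂) ℂ,
      X = U * rectDiag d₁ d₂ σ * Vᴴ

theorem rectDiag_mul_conjTranspose {d₁ d₂ : ℕ} (h : d₁ ≤ d₂) (σ : Fin (min d₁ d₂) → ℝ) :
    rectDiag d₁ d₂ σ * (rectDiag d₁ d₂ σ)ᴴ =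
      diagonal fun i => ((σ (Fin.cast (min_eq_left h).symm i) ^ 2 : ℝ) : ℂ) := by
  ext i k
  rw [mul_apply, Finset.sum_eq_single (Fin.castLE h i)]
  · by_cases hik : i = k
    · subst hik
      simp [rectDiag, sq, Fin.cast]
    · have : (k : ℕ) ≠ i := fun e => hik (Fin.ext e.symm)
      simp [rectDiag, hik, this]
  · intro j _ hj
    have : (i : ℕ) ≠ j := fun e => hj (Fin.ext e.symm)
    simp [rectDiag, this]
  · simp

theorem IsSVD.exists_mul_conjTranspose_add_smul_one {d₁ d₂ : ℕ} (h : d₁ ≤ d₂)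
    {X : Matrix (Fin d₁) (Fin d₂) ℂ} {σ : Fin (min d₁ d₂) → ℝ} (hX : IsSVD d₁ d₂ X σ) (ε : ℝ) :
    ∃ U ∈ unitaryGroup (Fin d₁) ℂ, X * Xᴴ + ((ε : ℂ) ^ 2) • (1 : Matrix (Fin d₁) (Fin d₁) ℂ) =
      U * diagonal (fun i => ((σ (Fin.cast (min_eq_left h).symm i) ^ 2 + ε ^ 2 : ℝ) : ℂ)) * Uᴴ := by
  obtain ⟨-, -, U, hU, V, hV, rfl⟩ := hX
  refine ⟨U, hU, ?_⟩
  have hU' : U * Uᴴ = 1 := mem_unitaryGroup_iff.mp hU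
  have hV' : Vᴴ * V = 1 := mem_unitaryGroup_iff'.mp hV
  have hdiag : diagonal (fun i => ((σ (Fin.cast (min_eq_left h).symm i) ^ 2 + ε ^ 2 : ℝ) : ℂ)) =
      rectDiag d₁ d₂ σ * (rectDiag d₁ d₂ σ)ᴴ + ((ε : ℂ) ^ 2) • (1 : Matrix (Fin d₁) (Fin d₁) ℂ) := by
    rw [rectDiag_mul_conjTranspose h, smul_one_eq_diagonal, diagonal_add]
    simp
  rw [hdiag, mul_add, add_mul, Matrix.mul_smul, Matrix.smul_mul, mul_one, hU']
  congr 1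
  calc U * rectDiag d₁ d₂ σ * Vᴴ * (U * rectDiag d₁ d₂ σ * Vᴴ)ᴴ
      = U * rectDiag d₁ d₂ σ * (Vᴴ * V) * (rectDiag d₁ d₂ σ)ᴴ * Uᴴ := by
        simp only [conjTranspose_mul, conjTranspose_conjTranspose, Matrix.mul_assoc]
    _ = U * (rectDiag d₁ d₂ σ * (rectDiag d₁ d₂ σ)ᴴ) * Uᴴ := by
        rw [hV', Matrix.mul_one, Matrix.mul_assoc U]

section

variable {n : Type*} [Fintype n] [DecidableEq n]

theorem sum_normSq_row_of_mem_unitaryGroup {Q : Matrix n n ℂ} (hQ : Q ∈ unitaryGroup n ℂ) (i : n) :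
    ∑ j, Complex.normSq (Q i j) = 1 := by
  have := congrFun (congrFun (mem_unitaryGroup_iff.mp hQ) i) i
  rw [mul_apply, one_apply_eq] at this
  exact_mod_cast (by simpa [star_apply, Complex.mul_conj] using this :
    ∑ j, (Complex.normSq (Q i j) : ℂ) = 1)

theorem sum_normSq_col_of_mem_unitaryGroup {Q : Matrix n n ℂ} (hQ : Q ∈ unitaryGroup n ℂ) (j : n) :
    ∑ i, Complex.normSq (Q i j) = 1 := by
  simpa [star_apply] using sum_normSq_row_of_mem_unitaryGroup (Unitary.star_mem hQ) j

theorem trace_diagonal_mul_conj_diagonal (c b : n → ℝ) (Q : Matrix n n ℂ) :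
    (diagonal (fun i => (c i : ℂ)) * (Q * diagonal (fun j => (b j : ℂ)) * Qᴴ)).trace =
      ((∑ i, ∑ j, Complex.normSq (Q i j) * (c i * b j) : ℝ) : ℂ) := by
  push_cast
  simp only [trace, diag_apply, diagonal_mul]
  simp only [mul_apply (N := Qᴴ), mul_diagonal, conjTranspose_apply, Finset.mul_sum,
    ← Complex.mul_conj, Complex.star_def]
  refine Finset.sum_congr rfl fun i _ => Finset.sum_congr rfl fun j _ => ?_
  ring

theorem sum_log_le_sum_log_add_trace_inv_mul_sub {U W : Matrix n n ℂ} (hU : U ∈ unitaryGroup n ℂ)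
    (hW : W ∈ unitaryGroup n ℂ) {a b : n → ℝ} (ha : ∀ i, 0 < a i) (hb : ∀ i, 0 < b i) :
    ∑ i, Real.log (b i) ≤ ∑ i, Real.log (a i) +
      (((U * diagonal (fun i => (a i : ℂ)) * Uᴴ)⁻¹ *
        (W * diagonal (fun i => (b i : ℂ)) * Wᴴ -
          U * diagonal (fun i => (a i : ℂ)) * Uᴴ)).trace).re := by
  have hU₁ : U * Uᴴ = 1 := mem_unitaryGroup_iff.mp hU
  have hU₂ : Uᴴ * U = 1 := mem_unitaryGroup_iff'.mp hU
  set D : Matrix n n ℂ := diagonal fun i => (a i : ℂ) with hD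
  set E : Matrix n n ℂ := diagonal fun i => (((a i)⁻¹ : ℝ) : ℂ) with hE
  have hED : E * D = 1 := by
    rw [hE, hD, diagonal_mul_diagonal, ← diagonal_one]
    congr 1
    ext i
    rw [← Complex.ofReal_mul, inv_mul_cancel₀ (ha i).ne', Complex.ofReal_one]
  have hleft : U * E * Uᴴ * (U * D * Uᴴ) = 1 := by
    calc U * E * Uᴴ * (U * D * Uᴴ) = U * E * (Uᴴ * U) * D * Uᴴ := by
          simp only [Matrix.mul_assoc]
      _ = U * (E * D) * Uᴴ := by rw [hU₂, Matrix.mul_one, Matrix.mul_assoc U]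
      _ = 1 := by rw [hED, Matrix.mul_one, hU₁]
  have hQ : Uᴴ * W ∈ unitaryGroup n ℂ := mul_mem (Unitary.star_mem hU) hW
  set Q := Uᴴ * W with hQdef
  have htrace : (U * E * Uᴴ * (W * diagonal (fun i => (b i : ℂ)) * Wᴴ)).trace =
      ((∑ i, ∑ j, Complex.normSq (Q i j) * ((a i)⁻¹ * b j) : ℝ) : ℂ) := by
    rw [← trace_diagonal_mul_conj_diagonal, ← hE, hQdef, Matrix.mul_assoc, Matrix.mul_assoc,
      trace_mul_comm U]
    simp only [conjTranspose_mul, conjTranspose_conjTranspose, Matrix.mul_assoc]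
  rw [inv_eq_left_inv hleft, mul_sub, hleft, trace_sub, htrace, trace_one, Complex.sub_re,
    Complex.ofReal_re, Complex.natCast_re]
  have hlog : ∀ i j, Real.log (b j) - Real.log (a i) ≤ (a i)⁻¹ * b j - 1 := fun i j => by
    rw [← Real.log_div (hb j).ne' (ha i).ne', inv_mul_eq_div]
    exact Real.log_le_sub_one_of_pos (div_pos (hb j) (ha i))
  have hsum : ∑ i, ∑ j, Complex.normSq (Q i j) * (Real.log (b j) - Real.log (a i)) ≤
      ∑ i, ∑ j, Complex.normSq (Q i j) * ((a i)⁻¹ * b j - 1) :=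
    Finset.sum_le_sum fun i _ => Finset.sum_le_sum fun j _ =>
      mul_le_mul_of_nonneg_left (hlog i j) (Complex.normSq_nonneg _)
  have hrow := sum_normSq_row_of_mem_unitaryGroup hQ
  have hcol := sum_normSq_col_of_mem_unitaryGroup hQ
  simp only [mul_sub, Finset.sum_sub_distrib, mul_one, hrow] at hsum
  rw [Finset.sum_comm] at hsum
  simp only [← Finset.sum_mul, hrow, hcol, one_mul, Finset.sum_const, Finset.card_univ,
    nsmul_eq_mul, mul_one] at hsum
  linarith

end

/-- Let `d₁ ≤ d₂`, `X, Z ∈ ℂ^{d₁×d₂}` and `ε > 0`.  Then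
`‖Z‖_{0,ε}⁰ ≤ ‖X‖_{0,ε}⁰ + tr((XX^* + ε²I_{d₁})⁻¹(ZZ^* − XX^*))`: the affine
function of `Z` on the right-hand side is a global majorizer of `Z ↦ ‖Z‖_{0,ε}⁰`
that is tight at `Z = X`. -/
theorem logdet_surrogate_quadratic_majorizer (d₁ d₂ : ℕ) (h : d₁ ≤ d₂)
    (X Z : Matrix (Fin d₁) (Fin d₂) ℂ)
    (σX σZ : Fin (min d₁ d₂) → ℝ)
    (hX : IsSVD d₁ d₂ X σX) (hZ : IsSVD d₁ d₂ Z σZ) (ε : ℝ) (hε : 0 < ε) :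
    (∑ i, Real.log (σZ i ^ 2 + ε ^ 2))
      ≤ (∑ i, Real.log (σX i ^ 2 + ε ^ 2))
        + (((X * Xᴴ + ((ε : ℂ) ^ 2) • (1 : Matrix (Fin d₁) (Fin d₁) ℂ))⁻¹
            * (Z * Zᴴ - X * Xᴴ)).trace).re := by
  obtain ⟨U, hU, hXU⟩ := hX.exists_mul_conjTranspose_add_smul_one h ε
  obtain ⟨W, hW, hZW⟩ := hZ.exists_mul_conjTranspose_add_smul_one h ε
  rw [← add_sub_add_right_eq_sub (Z * Zᴴ) (X * Xᴴ)
      (((ε : ℂ) ^ 2) • (1 : Matrix (Fin d₁) (Fin d₁) ℂ)), hXU, hZW,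
    ← (finCongr (min_eq_left h).symm).sum_comp, ← (finCongr (min_eq_left h).symm).sum_comp]
  exact sum_log_le_sum_log_add_trace_inv_mul_sub hU hW (fun _ => by positivity)
    (fun _ => by positivity)
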